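/- Let R be an integral domain with fraction field K, M a finitely generated free R-module of rank m, and X a closed subset of affine space 𝔸^m over R with vanishing ideal I ⊆ R[x_1,...,x_m]. Then there exists a nonzero r ∈ R such that for all primes p ∈ Spec(R[1/r]), the dimension of the variety X(\bar{K_p}) ⊆ \bar{K_p}^m cut out by the image of I equals the dimension of X(\bar{K}) ⊆ \bar{K}^m. In other words, the function p ↦ dim X(\bar{K_p}) on Spec(R) is constant on a dense open subset. -/

import Mathlib

open MvPolynomial

/-- The zero set, in `F^m`, of (the image under `ρ` of) an ideal of `R[x_1,...,x_m]`. -/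
def zeroSet {R F : Type*} [CommRing R] [CommRing F] {m : ℕ}
    (I : Ideal (MvPolynomial (Fin m) R)) (ρ : R →+* F) : Set (Fin m → F) :=
  {x | ∀ f ∈ I, MvPolynomial.eval x (MvPolynomial.map ρ f) = 0}

/-- The vanishing ideal of a subset of `F^m`. -/
def vanishIdeal {F : Type*} [CommRing F] {m : ℕ} (Z : Set (Fin m → F)) :
    Ideal (MvPolynomial (Fin m) F) where
  carrier := {g | ∀ x ∈ Z, MvPolynomial.eval x g = 0}
  add_mem' := by
    intro a b ha hb x hx
    simp [map_add, ha x hx, hb x hx]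
  zero_mem' := by intro x _; simp
  smul_mem' := by
    intro c a ha x hx
    simp [smul_eq_mul, ha x hx]

open TensorProduct

theorem ringKrullDim_eq_of_isIntegral_of_injective {R S : Type*} [CommRing R] [CommRing S]
    [Algebra R S] [Algebra.IsIntegral R S] (h : Function.Injective (algebraMap R S)) :
    ringKrullDim S = ringKrullDim R := by
  have : FaithfulSMul R S := (faithfulSMul_iff_algebraMap_injective R S).mpr h
  apply le_antisymm
  · refine Order.krullDim_le_of_strictMono (PrimeSpectrum.comap (algebraMap R S)) fun P Q hPQ ↦ ?_
    exact Ideal.IsIntegral.comap_lt_comap (R := R) (I := P.asIdeal) (J := Q.asIdeal) hPQ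
  · refine iSup_le fun l ↦ ?_
    obtain ⟨P, hP, hPl⟩ := Ideal.nonempty_primesOver (S := S) l.head.asIdeal
    obtain ⟨l', hl', -⟩ := Ideal.exists_ltSeries_of_hasGoingUp l P
    exact hl' ▸ le_iSup (fun l : LTSeries (PrimeSpectrum S) ↦ (l.length : WithBot ℕ∞)) l'

theorem ringKrullDim_quotient_radical {R : Type*} [CommRing R] (I : Ideal R) :
    ringKrullDim (R ⧸ I.radical) = ringKrullDim (R ⧸ I) := by
  rw [ringKrullDim_quotient, ringKrullDim_quotient, PrimeSpectrum.zeroLocus_radical]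

theorem exists_ringHom_comp_algebraMap_eq_of_isIntegral {C A L : Type*} [CommRing C] [CommRing A]
    [Field L] [IsAlgClosed L] [Algebra C A] [Algebra.IsIntegral C A]
    (h : Function.Injective (algebraMap C A)) (φ : C →+* L) :
    ∃ ψ : A →+* L, ψ.comp (algebraMap C A) = φ := by
  have : FaithfulSMul C A := (faithfulSMul_iff_algebraMap_injective C A).mpr h
  set q := RingHom.ker φ with hq
  have hqp : q.IsPrime := RingHom.ker_isPrime φ
  obtain ⟨Q, hQ, hQq⟩ := Ideal.nonempty_primesOver (S := A) q
  let : Algebra (C ⧸ q) L := (RingHom.kerLift φ).toAlgebra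
  have : FaithfulSMul (C ⧸ q) L :=
    (faithfulSMul_iff_algebraMap_injective _ _).mpr (RingHom.kerLift_injective φ)
  have hinj : Function.Injective (algebraMap (C ⧸ q) (A ⧸ Q)) := by
    rw [RingHom.injective_iff_ker_eq_bot, RingHom.ker_eq_bot_iff_eq_zero]
    intro x hx
    obtain ⟨c, rfl⟩ := Ideal.Quotient.mk_surjective x
    rw [Ideal.Quotient.eq_zero_iff_mem, hQq.over, Ideal.under_def, Ideal.mem_comap,
      ← Ideal.Quotient.eq_zero_iff_mem]
    exact hx
  have : Module.IsTorsionFree (C ⧸ q) (A ⧸ Q) :=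
    Module.isTorsionFree_iff_faithfulSMul.mpr ((faithfulSMul_iff_algebraMap_injective _ _).mpr hinj)
  let f : A ⧸ Q →ₐ[C ⧸ q] L := IsAlgClosed.lift
  refine ⟨f.toRingHom.comp (Ideal.Quotient.mk Q), RingHom.ext fun c ↦ ?_⟩
  have := f.commutes (Ideal.Quotient.mk q c)
  exact this

theorem exists_ringHom_comp_algebraMap_eq_of_isIntegral_smul {C A L : Type*} [CommRing C]
    [CommRing A] [Field L] [IsAlgClosed L] [Algebra C A] (h : Function.Injective (algebraMap C A))
    (r : C) (hr : ∀ a : A, ∃ n : ℕ, IsIntegral C (r ^ n • a)) (φ : C →+* L) (hφ : φ r ≠ 0) :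
    ∃ ψ : A →+* L, ψ.comp (algebraMap C A) = φ := by
  let M := Submonoid.powers r
  let Cr := Localization M
  let Ar := Localization (Algebra.algebraMapSubmonoid A M)
  let : Algebra Cr Ar := localizationAlgebra M A
  have hinj : Function.Injective (algebraMap Cr Ar) := localizationAlgebra_injective Cr Ar h
  have hint : Algebra.IsIntegral Cr Ar := by
    refine ⟨fun x ↦ ?_⟩
    obtain ⟨⟨a, s⟩, hx⟩ := IsLocalization.surj (Algebra.algebraMapSubmonoid A M) x
    obtain ⟨s, _, ⟨k, rfl⟩, rfl⟩ := s
    obtain ⟨n, hn⟩ := hr a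
    have hu : IsUnit (algebraMap C Cr (r ^ (n + k))) :=
      IsLocalization.map_units (M := M) Cr ⟨_, n + k, rfl⟩
    obtain ⟨v, hv⟩ := hu.exists_left_inv
    refine IsIntegral.of_mul_unit (R := Cr) (y := algebraMap C Ar (r ^ (n + k))) (r := v) ?_ ?_
    · rw [IsScalarTower.algebraMap_apply C Cr Ar, ← map_mul, hv, map_one]
    · have := (hn.map (IsScalarTower.toAlgHom C A Ar)).tower_top (A := Cr)
      convert this using 1
      simp only [IsScalarTower.coe_toAlgHom', Algebra.smul_def, map_mul, ← hx, pow_add,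
        IsScalarTower.algebraMap_apply C A Ar]
      ring
  obtain ⟨ψ, hψ⟩ := exists_ringHom_comp_algebraMap_eq_of_isIntegral hinj
    (IsLocalization.lift (M := M) (S := Cr) (g := φ) (by
      rintro ⟨_, n, rfl⟩; simpa using fun h ↦ absurd h hφ))
  refine ⟨ψ.comp (algebraMap A Ar), ?_⟩
  rw [RingHom.comp_assoc, ← IsScalarTower.algebraMap_eq, IsScalarTower.algebraMap_eq C Cr Ar,
    ← RingHom.comp_assoc, hψ, IsLocalization.lift_comp]

theorem exists_pow_smul_isIntegral {R C A : Type*} [CommRing R] [CommRing C] [CommRing A]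
    [Algebra R C] [Algebra R A] [Algebra C A] [IsScalarTower R C A] {s : Set A}
    (hs : Algebra.adjoin R s = ⊤) {r : R} (hr : ∀ x ∈ s, IsIntegral C (r • x)) (a : A) :
    ∃ n : ℕ, IsIntegral C (r ^ n • a) := by
  have ha : a ∈ Algebra.adjoin R s := hs ▸ Algebra.mem_top
  induction ha using Algebra.adjoin_induction with
  | mem x hx => exact ⟨1, by simpa using hr x hx⟩
  | algebraMap c =>
    refine ⟨0, ?_⟩
    rw [pow_zero, one_smul, IsScalarTower.algebraMap_apply R C A]
    exact isIntegral_algebraMap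
  | add x y _ _ hx hy =>
    obtain ⟨n, hn⟩ := hx
    obtain ⟨k, hk⟩ := hy
    refine ⟨n + k, ?_⟩
    rw [smul_add]
    refine .add ?_ ?_
    · rw [pow_add, mul_comm, mul_smul]
      exact hn.smul _
    · rw [pow_add, mul_smul]
      exact hk.smul _
  | mul x y _ _ hx hy =>
    obtain ⟨n, hn⟩ := hx
    obtain ⟨k, hk⟩ := hy
    exact ⟨n + k, by rw [pow_add, ← smul_mul_smul_comm]; exact hn.mul hk⟩

theorem ringKrullDim_tensorProduct_of_injective_of_isIntegral_smul {R A F : Type*} [CommRing R]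
    [CommRing A] [Field F] [Algebra R A] [Algebra R F] {d : ℕ} (g : MvPolynomial (Fin d) R →ₐ[R] A)
    (hg : Function.Injective g) {s : Set A} (hs : Algebra.adjoin R s = ⊤) {r : R}
    (hr : ∀ x ∈ s, g.toRingHom.IsIntegralElem (r • x)) (hrF : algebraMap R F r ≠ 0) :
    ringKrullDim (F ⊗[R] A) = d := by
  let C := MvPolynomial (Fin d) R
  let : Algebra C A := g.toRingHom.toAlgebra
  have : IsScalarTower R C A := .of_algebraMap_eq fun x ↦ (g.commutes x).symm
  have hpow (a : A) : ∃ n : ℕ, IsIntegral C (r ^ n • a) := exists_pow_smul_isIntegral hs hr a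
  let T := F ⊗[R] A
  let h : MvPolynomial (Fin d) F →ₐ[F] T := aeval fun i ↦ 1 ⊗ₜ g (X i)
  let ι : A →ₐ[R] T := Algebra.TensorProduct.includeRight
  have hι (a : A) : ι a = 1 ⊗ₜ a := rfl
  have hcomp : h.toRingHom.comp (MvPolynomial.map (algebraMap R F)) = ι.toRingHom.comp g.toRingHom := by
    ext x
    · simpa [h, hι] using! Algebra.TensorProduct.tmul_one_eq_one_tmul (A := F) (B := A) x
    · simp [h, hι]
  let : Algebra (MvPolynomial (Fin d) F) T := h.toRingHom.toAlgebra
  have : IsScalarTower F (MvPolynomial (Fin d) F) T :=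
    .of_algebraMap_eq fun x ↦ (h.commutes x).symm
  have hinj : Function.Injective h := by
    let L := AlgebraicClosure (FractionRing (MvPolynomial (Fin d) F))
    let φ : C →+* L := (algebraMap (MvPolynomial (Fin d) F) L).comp (MvPolynomial.map (algebraMap R F))
    have hL : Function.Injective (algebraMap (MvPolynomial (Fin d) F) L) := by
      rw [IsScalarTower.algebraMap_eq _ (FractionRing (MvPolynomial (Fin d) F)) L]
      exact (algebraMap (FractionRing (MvPolynomial (Fin d) F)) L).injective.comp
        (IsFractionRing.injective _ _)
    obtain ⟨ψ, hψ⟩ := exists_ringHom_comp_algebraMap_eq_of_isIntegral_smul (C := C) (A := A) hg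
      (algebraMap R C r) (fun a ↦ by simpa only [← map_pow, algebraMap_smul] using hpow a) φ (by
        simpa only [φ, C, RingHom.comp_apply, algebraMap_eq, map_C, ne_eq,
          map_eq_zero_iff _ hL, C_eq_zero] using hrF)
    let ψ' : A →ₐ[R] L := ⟨ψ, fun x ↦ by
      change ψ (algebraMap R A x) = _
      rw [IsScalarTower.algebraMap_apply R C A, ← RingHom.comp_apply, hψ,
        IsScalarTower.algebraMap_apply R (MvPolynomial (Fin d) F) L]
      simp [φ, C, MvPolynomial.algebraMap_apply, -algebraMap_eq]⟩
    let θ : T →ₐ[F] L := Algebra.TensorProduct.lift (Algebra.ofId F L) ψ' fun _ _ ↦ .all _ _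
    have hθ : θ.comp h = IsScalarTower.toAlgHom F (MvPolynomial (Fin d) F) L := by
      ext i
      have hX : h (X i) = 1 ⊗ₜ g (X i) := aeval_X _ i
      have hψX : ψ (g (X i)) = algebraMap (MvPolynomial (Fin d) F) L (X i) := by
        have := RingHom.congr_fun hψ (X i)
        rwa [RingHom.comp_apply, RingHom.comp_apply, map_X] at this
      rw [AlgHom.comp_apply, hX, IsScalarTower.toAlgHom_apply, ← hψX]
      exact (Algebra.TensorProduct.lift_tmul _ _ _ _ _).trans (by rw [map_one, one_mul]; rfl)
    refine .of_comp (f := θ) ?_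
    rw [← AlgHom.coe_comp, hθ]
    exact hL
  have hint : Algebra.IsIntegral (MvPolynomial (Fin d) F) T := by
    refine ⟨fun x ↦ ?_⟩
    induction x using TensorProduct.induction_on with
    | zero => exact isIntegral_zero
    | add x y hx hy => exact hx.add hy
    | tmul c a =>
      obtain ⟨n, hn⟩ := hpow a
      have hna : IsIntegral (MvPolynomial (Fin d) F) (ι (r ^ n • a)) :=
        hn.map_of_comp_eq (MvPolynomial.map (algebraMap R F)) ι.toRingHom hcomp
      have : c ⊗ₜ[R] a = (c * (algebraMap R F r ^ n)⁻¹) • ι (r ^ n • a) := by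
        rw [map_smul, ← algebraMap_smul F (r ^ n) (ι a), smul_smul, map_pow, mul_assoc,
          inv_mul_cancel₀ (pow_ne_zero n hrF), mul_one, hι, TensorProduct.smul_tmul', smul_eq_mul,
          mul_one]
      rw [this]
      exact hna.smul _
  rw [ringKrullDim_eq_of_isIntegral_of_injective (R := MvPolynomial (Fin d) F) hinj,
    MvPolynomial.ringKrullDim_of_isNoetherianRing]
  simp

theorem MvPolynomial.aeval_smul_X_bijective {σ K : Type*} [Field K] {c : K} (hc : c ≠ 0) :
    Function.Bijective (aeval fun i ↦ c • X i : MvPolynomial σ K →ₐ[K] MvPolynomial σ K) := by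
  let τ : MvPolynomial σ K →ₐ[K] MvPolynomial σ K := aeval fun i ↦ c⁻¹ • X i
  have h₁ : τ.comp (aeval fun i ↦ c • X i) = .id _ _ := by
    ext i : 1
    simp [τ, smul_smul, hc]
  have h₂ : (aeval fun i ↦ c • X i).comp τ = .id _ _ := by
    ext i : 1
    simp [τ, smul_smul, hc]
  exact ⟨Function.LeftInverse.injective (g := τ) (AlgHom.congr_fun h₁),
    Function.RightInverse.surjective (g := τ) (AlgHom.congr_fun h₂)⟩

theorem exists_injective_isIntegral_smul {R A : Type*} [CommRing R] [IsDomain R] [CommRing A]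
    [Algebra R A] {s : Set A} (hfin : s.Finite) (hs : Algebra.adjoin R s = ⊤)
    [Nontrivial (FractionRing R ⊗[R] A)] :
    ∃ (d : ℕ) (g : MvPolynomial (Fin d) R →ₐ[R] A) (r : R), r ≠ 0 ∧ Function.Injective g ∧
      ∀ x ∈ s, g.toRingHom.IsIntegralElem (r • x) := by
  let K := FractionRing R
  let T := K ⊗[R] A
  have : Algebra.FiniteType R A := ⟨⟨hfin.toFinset, by simpa using hs⟩⟩
  let : Algebra A T := Algebra.TensorProduct.rightAlgebra
  let M := Algebra.algebraMapSubmonoid A (nonZeroDivisors R)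
  have : IsLocalization M T := inferInstance
  obtain ⟨d, g₀, hg₀, hi₀⟩ := exists_integral_inj_algHom_of_fg K T
  obtain ⟨⟨_, b, hb, rfl⟩, hba⟩ := IsLocalization.exist_integer_multiples_of_finite M
    (fun i ↦ g₀ (X i))
  choose a ha using hba
  have hb0 : algebraMap R K b ≠ 0 := by simpa [K] using nonZeroDivisors.ne_zero hb
  let σ : MvPolynomial (Fin d) K →ₐ[K] MvPolynomial (Fin d) K :=
    aeval fun i ↦ algebraMap R K b • X i
  have hσ : Function.Bijective σ := aeval_smul_X_bijective hb0
  let C' := MvPolynomial (Fin d) R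
  let P := MvPolynomial (Fin d) K
  let g : C' →ₐ[R] A := aeval a
  let g₁ : P →ₐ[K] T := g₀.comp σ
  let : Algebra C' A := g.toRingHom.toAlgebra
  let : Algebra P T := g₁.toRingHom.toAlgebra
  let : Algebra C' P := algebraMvPolynomial
  let : Algebra C' T := ((algebraMap A T).comp g.toRingHom).toAlgebra
  have : IsScalarTower C' A T := .of_algebraMap_eq' rfl
  have hcomp : (algebraMap A T).comp g.toRingHom =
      g₁.toRingHom.comp (MvPolynomial.map (algebraMap R K)) := by
    refine MvPolynomial.ringHom_ext (fun c ↦ ?_) fun i ↦ ?_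
    · have h₁ : g (C c) = algebraMap R A c := g.commutes c
      have h₂ : g₁ (MvPolynomial.map (algebraMap R K) (C c)) = algebraMap K T (algebraMap R K c) :=
        (congrArg g₁ (map_C _ _)).trans (g₁.commutes _)
      refine (congrArg (algebraMap A T) h₁).trans (Eq.trans ?_ h₂.symm)
      exact (Algebra.TensorProduct.tmul_one_eq_one_tmul (A := K) (B := A) c).symm
    · have h₁ : g (X i) = a i := aeval_X _ _
      have h₂ : g₁ (MvPolynomial.map (algebraMap R K) (X i)) = algebraMap R K b • g₀ (X i) := by
        refine (congrArg g₁ (map_X _ _)).trans ?_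
        change g₀ (σ (X i)) = _
        rw [show σ (X i) = algebraMap R K b • X i from aeval_X _ _, map_smul]
      refine (congrArg (algebraMap A T) h₁).trans ((ha i).trans (Eq.trans ?_ h₂.symm))
      refine (Algebra.smul_def (R := A) _ _).trans (Eq.trans ?_
        (Algebra.smul_def (R := K) (A := T) (algebraMap R K b) (g₀ (X i))).symm)
      refine congrArg (· * g₀ (X i)) ?_
      exact (Algebra.TensorProduct.tmul_one_eq_one_tmul (A := K) (B := A) b).symm
  have : IsScalarTower C' P T := .of_algebraMap_eq' hcomp
  have hginj : Function.Injective g := by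
    have : Function.Injective (g₁.toRingHom.comp (MvPolynomial.map (algebraMap R K))) :=
      (hg₀.comp hσ.1).comp (map_injective _ (IsFractionRing.injective R K))
    rw [← hcomp] at this
    exact fun x y h ↦ this (congrArg (algebraMap A T) h)
  have : Algebra.IsIntegral P T := ⟨(RingHom.isIntegral_of_surjective _ hσ.2).trans _ _ hi₀⟩
  let N : Submonoid C' := (nonZeroDivisors R).map C
  have hN : Algebra.algebraMapSubmonoid A N = M := by
    ext x
    constructor
    · rintro ⟨_, ⟨c, hc, rfl⟩, rfl⟩
      exact ⟨c, hc, (g.commutes c).symm⟩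
    · rintro ⟨c, hc, rfl⟩
      exact ⟨_, ⟨c, hc, rfl⟩, g.commutes c⟩
  have : IsLocalization N P := MvPolynomial.isLocalization _ _
  have : IsLocalization (Algebra.algebraMapSubmonoid A N) T := hN ▸ inferInstance
  have : IsScalarTower R C' A := .of_algebraMap_eq fun x ↦ (g.commutes x).symm
  have key (x : A) : ∃ r : R, r ≠ 0 ∧ IsIntegral C' (r • x) := by
    obtain ⟨⟨_, m, hm, rfl⟩, h⟩ := IsIntegral.exists_multiple_integral_of_isLocalization N _
      (Algebra.IsIntegral.isIntegral (R := P) (algebraMap A T x))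
    have h' : IsIntegral C' (algebraMap A T ((C m : C') • x)) := by
      rw [← algebraMap_smul A, Algebra.smul_def, map_mul, ← IsScalarTower.algebraMap_apply,
        ← Algebra.smul_def]
      exact h
    obtain ⟨_, ⟨m', hm', rfl⟩, h''⟩ :=
      IsLocalization.exists_isIntegral_smul_of_isIntegral_map (R := C') (S := A) (Sₘ := T) N h'
    refine ⟨m' * m, nonZeroDivisors.ne_zero (mul_mem hm' hm), ?_⟩
    rwa [smul_smul, ← map_mul, ← algebraMap_eq, algebraMap_smul] at h''
  choose r hr0 hr using key
  classical
  refine ⟨d, g, ∏ x ∈ hfin.toFinset, r x, Finset.prod_ne_zero_iff.mpr fun x _ ↦ hr0 x, hginj,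
    fun x hx ↦ ?_⟩
  rw [← Finset.prod_erase_mul _ _ (hfin.mem_toFinset.mpr hx), mul_smul]
  exact (hr x).smul _

theorem exists_forall_ringKrullDim_tensorProduct_eq (R A : Type*) [CommRing R] [IsDomain R]
    [CommRing A] [Algebra R A] [Algebra.FiniteType R A] :
    ∃ (r : R) (n : WithBot ℕ∞), r ≠ 0 ∧ ∀ (F : Type _) [Field F] [Algebra R F],
      algebraMap R F r ≠ 0 → ringKrullDim (F ⊗[R] A) = n := by
  cases subsingleton_or_nontrivial (FractionRing R ⊗[R] A)
  · let : Algebra A (FractionRing R ⊗[R] A) := Algebra.TensorProduct.rightAlgebra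
    have : IsLocalization (Algebra.algebraMapSubmonoid A (nonZeroDivisors R))
      (FractionRing R ⊗[R] A) := inferInstance
    obtain ⟨⟨_, r, hr, rfl⟩, h⟩ := (IsLocalization.map_eq_zero_iff
      (Algebra.algebraMapSubmonoid A (nonZeroDivisors R)) (FractionRing R ⊗[R] A) (1 : A)).mp
      (Subsingleton.elim _ _)
    replace h : algebraMap R A r = 0 := by simpa using h
    refine ⟨r, ⊥, nonZeroDivisors.ne_zero hr, fun F _ _ hF ↦ ?_⟩
    have : Subsingleton (F ⊗[R] A) := by
      refine subsingleton_of_zero_eq_one ?_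
      have h₁ : algebraMap R F r ⊗ₜ[R] (1 : A) = 0 := by
        rw [Algebra.TensorProduct.tmul_one_eq_one_tmul, h, TensorProduct.tmul_zero]
      have h₂ := congrArg ((algebraMap R F r)⁻¹ • ·) h₁
      simp only [smul_zero, TensorProduct.smul_tmul', smul_eq_mul, inv_mul_cancel₀ hF] at h₂
      exact h₂.symm
    exact ringKrullDim_eq_bot_of_subsingleton
  · obtain ⟨s, hs⟩ := Algebra.FiniteType.out (R := R) (A := A)
    obtain ⟨d, g, r, hr, hg, hgr⟩ := exists_injective_isIntegral_smul s.finite_toSet hs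
    exact ⟨r, d, hr, fun F _ _ hF ↦
      ringKrullDim_tensorProduct_of_injective_of_isIntegral_smul g hg hs hgr hF⟩

theorem vanishIdeal_zeroSet {R F : Type*} [CommRing R] [Field F] [IsAlgClosed F] {m : ℕ}
    (I : Ideal (MvPolynomial (Fin m) R)) (ρ : R →+* F) :
    vanishIdeal (zeroSet I ρ) = (I.map (MvPolynomial.map ρ)).radical := by
  rw [← MvPolynomial.vanishingIdeal_zeroLocus_eq_radical (K := F)]
  have h : zeroSet I ρ = zeroLocus F (I.map (MvPolynomial.map ρ)) := by
    ext x
    have : x ∈ zeroSet I ρ ↔ I.map (MvPolynomial.map ρ) ≤ RingHom.ker (MvPolynomial.eval x) := by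
      rw [Ideal.map_le_iff_le_comap]
      rfl
    rw [this, mem_zeroLocus_iff]
    simp [SetLike.le_def, RingHom.mem_ker, aeval_eq_eval]
  rw [h]
  ext p
  rw [mem_vanishingIdeal_iff]
  rfl

theorem ringKrullDim_quotient_vanishIdeal_zeroSet {R F : Type*} [CommRing R] [Field F]
    [Algebra R F] [IsAlgClosed F] {m : ℕ} (I : Ideal (MvPolynomial (Fin m) R)) :
    ringKrullDim (MvPolynomial (Fin m) F ⧸ vanishIdeal (zeroSet I (algebraMap R F))) =
      ringKrullDim (F ⊗[R] (MvPolynomial (Fin m) R ⧸ I)) := by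
  rw [vanishIdeal_zeroSet, ringKrullDim_quotient_radical]
  refine (ringKrullDim_eq_of_ringEquiv
    ((Algebra.TensorProduct.tensorQuotientEquiv (R := R) F
      (MvPolynomial (Fin m) R) F I).toRingEquiv.trans
        (Ideal.quotientEquiv _ _ (algebraTensorAlgEquiv R F).toRingEquiv ?_))).symm
  refine Eq.trans ?_ (Ideal.map_map (I := I)
    (Algebra.TensorProduct.includeRight : _ →ₐ[R] F ⊗[R] MvPolynomial (Fin m) R).toRingHom
    (algebraTensorAlgEquiv R F).toRingEquiv.toRingHom).symm
  congr 1
  refine MvPolynomial.ringHom_ext (fun c ↦ ?_) fun i ↦ ?_ <;> simp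

/-- Let `R` be a domain with fraction field `K` and let `X` be a closed subset of affine `m`-space
over `R`, with vanishing ideal `I ⊆ R[x_1,...,x_m]`.  Then there is a nonzero `r ∈ R` such that
for every prime `p` of `R[1/r]` (i.e. every prime of `R` not containing `r`), the Krull dimension
of the variety `X(K̄_p) ⊆ K̄_p^m` (measured via its coordinate ring) equals that of
`X(K̄) ⊆ K̄^m`; i.e. the dimension function `p ↦ dim X(K̄_p)` is constant on a dense open subset
of `Spec R`. -/
theorem dimension_constant_on_dense_open (R : Type*) [CommRing R] [IsDomain R] (m : ℕ)
    (I : Ideal (MvPolynomial (Fin m) R)) :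
    ∃ r : R, r ≠ 0 ∧ ∀ (p : Ideal R) [p.IsPrime], r ∉ p →
      ringKrullDim (MvPolynomial (Fin m) (AlgebraicClosure (FractionRing (R ⧸ p))) ⧸
        vanishIdeal (zeroSet I
          ((algebraMap (FractionRing (R ⧸ p))
              (AlgebraicClosure (FractionRing (R ⧸ p)))).comp
            ((algebraMap (R ⧸ p) (FractionRing (R ⧸ p))).comp (Ideal.Quotient.mk p)))))
      = ringKrullDim (MvPolynomial (Fin m) (AlgebraicClosure (FractionRing R)) ⧸
          vanishIdeal (zeroSet I
            ((algebraMap (FractionRing R) (AlgebraicClosure (FractionRing R))).comp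
              (algebraMap R (FractionRing R))))) := by
  obtain ⟨r, n, hr, h⟩ := exists_forall_ringKrullDim_tensorProduct_eq R (MvPolynomial (Fin m) R ⧸ I)
  refine ⟨r, hr, fun p _ hp ↦ ?_⟩
  trans n
  · let : Algebra R (AlgebraicClosure (FractionRing (R ⧸ p))) :=
      ((algebraMap (FractionRing (R ⧸ p)) (AlgebraicClosure (FractionRing (R ⧸ p)))).comp
        ((algebraMap (R ⧸ p) (FractionRing (R ⧸ p))).comp (Ideal.Quotient.mk p))).toAlgebra
    refine (ringKrullDim_quotient_vanishIdeal_zeroSet I).trans (h _ ?_)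
    simpa [RingHom.algebraMap_toAlgebra, Ideal.Quotient.eq_zero_iff_mem] using hp
  · let : Algebra R (AlgebraicClosure (FractionRing R)) :=
      ((algebraMap (FractionRing R) (AlgebraicClosure (FractionRing R))).comp
        (algebraMap R (FractionRing R))).toAlgebra
    refine ((ringKrullDim_quotient_vanishIdeal_zeroSet I).trans (h _ ?_)).symm
    simpa [RingHom.algebraMap_toAlgebra] using hr
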